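/- (Analytic core of Corollary 2: candid throughout is optimal for small λ.) Let σ > 0 and κ ∈ (0,1). (i) If λ > 0 satisfies e^{−λ g(1)} > κ·(1 + λ), then for every t ∈ [0,1]: e^{−λ g(t)} > κ·(1 + λ·h(t)·(1−t)). (ii) There exists λ₀ > 0 (depending on κ) such that the hypothesis of (i), and hence its conclusion, holds for all λ ∈ (0, λ₀]. -/

import Mathlib

/-- The standard normal cumulative distribution function
`Φ(x) = (1/√(2π)) ∫_{-∞}^x e^{-u²/2} du`. -/
noncomputable def Phi (x : ℝ) : ℝ :=
  (Real.sqrt (2 * Real.pi))⁻¹ * ∫ u in Set.Iic x, Real.exp (-u ^ 2 / 2)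

/-- The discount function `h(t) = 2Φ(σ(1-t)/2) - 1` for volatility `σ`. -/
noncomputable def h (σ t : ℝ) : ℝ := 2 * Phi (σ * (1 - t) / 2) - 1

/-- `g(t) = ∫₀ᵗ h(u) du`. -/
noncomputable def g (σ t : ℝ) : ℝ := ∫ u in (0:ℝ)..t, h σ u

/-- The explicit derivative of `h`: `h′(t) = -(σ/√(2π))·exp(-σ²(1-t)²/8)`. -/
noncomputable def hDeriv (σ t : ℝ) : ℝ :=
  -(σ / Real.sqrt (2 * Real.pi)) * Real.exp (-(σ ^ 2 * (1 - t) ^ 2) / 8)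

lemma aux_fun : (fun u : ℝ => Real.exp (-u ^ 2 / 2)) = fun u : ℝ => Real.exp (-(1/2 : ℝ) * u ^ 2) := by
  funext u; congr 1; ring

lemma aux_int : MeasureTheory.Integrable (fun u : ℝ => Real.exp (-u ^ 2 / 2)) := by
  rw [aux_fun]; exact integrable_exp_neg_mul_sq (by norm_num)

lemma aux_sqrt_pos : 0 < Real.sqrt (2 * Real.pi) := Real.sqrt_pos.2 (by positivity)

lemma aux_total : ∫ u : ℝ, Real.exp (-u ^ 2 / 2) = Real.sqrt (2 * Real.pi) := by
  rw [aux_fun, integral_gaussian]; congr 1; field_simp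

lemma aux_half : ∫ u in Set.Iic (0:ℝ), Real.exp (-u ^ 2 / 2) = Real.sqrt (2 * Real.pi) / 2 := by
  have h1 := integral_comp_neg_Iic (0:ℝ) (fun u : ℝ => Real.exp (-u ^ 2 / 2))
  simp only [neg_zero, neg_sq] at h1
  rw [h1, aux_fun, integral_gaussian_Ioi]; congr 2; field_simp

lemma Phi_mono : Monotone Phi := by
  intro a b hab
  unfold Phi
  apply mul_le_mul_of_nonneg_left _ (by positivity)
  apply MeasureTheory.setIntegral_mono_set aux_int.integrableOn
  · exact Filter.Eventually.of_forall fun u => (Real.exp_pos _).le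
  · exact (Set.Iic_subset_Iic.2 hab).eventuallyLE

lemma Phi_zero : Phi 0 = 1 / 2 := by
  unfold Phi
  rw [aux_half]
  have := aux_sqrt_pos
  field_simp

lemma Phi_le_one (x : ℝ) : Phi x ≤ 1 := by
  unfold Phi
  have h0 := aux_sqrt_pos
  rw [inv_mul_le_iff₀ h0, mul_one, ← aux_total]
  exact MeasureTheory.setIntegral_le_integral aux_int
    (Filter.Eventually.of_forall fun u => (Real.exp_pos _).le)

lemma h_le_one (σ t : ℝ) : h σ t ≤ 1 := by
  unfold h; linarith [Phi_le_one (σ * (1 - t) / 2)]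

lemma h_nonneg (σ t : ℝ) (hσ : 0 < σ) (ht : t ≤ 1) : 0 ≤ h σ t := by
  unfold h
  have : 0 ≤ σ * (1 - t) / 2 := div_nonneg (mul_nonneg hσ.le (by linarith)) (by norm_num)
  have := Phi_mono this
  rw [Phi_zero] at this
  linarith

lemma h_anti (σ : ℝ) (hσ : 0 < σ) : Antitone (h σ) := by
  intro a b hab
  have : σ * (1 - b) / 2 ≤ σ * (1 - a) / 2 := by gcongr
  have := Phi_mono this
  unfold h; linarith

lemma g_le (σ t : ℝ) (hσ : 0 < σ) (ht : t ≤ 1) : g σ t ≤ g σ 1 := by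
  unfold g
  rw [← intervalIntegral.integral_add_adjacent_intervals (b := t) (c := 1)
    (h_anti σ hσ).intervalIntegrable (h_anti σ hσ).intervalIntegrable]
  have := intervalIntegral.integral_nonneg ht (μ := MeasureTheory.volume)
    (fun u hu => h_nonneg σ u hσ hu.2)
  linarith

/-- Analytic core of Corollary 2: (i) if `e^{-λ g(1)} > κ(1+λ)` then the candid valuation `1`
stays strictly below the switching curve, i.e. `e^{-λ g(t)} > κ(1 + λ h(t)(1-t))` on `[0,1]`;
(ii) this hypothesis holds for all sufficiently small `λ > 0`. -/
theorem stmt_9 (σ κ : ℝ) (hσ : 0 < σ) (hκ : κ ∈ Set.Ioo (0:ℝ) 1) :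
    (∀ lam : ℝ, 0 < lam → κ * (1 + lam) < Real.exp (-(lam * g σ 1)) →
      ∀ t ∈ Set.Icc (0:ℝ) 1,
        κ * (1 + lam * h σ t * (1 - t)) < Real.exp (-(lam * g σ t))) ∧
    (∃ lam0 : ℝ, 0 < lam0 ∧ ∀ lam ∈ Set.Ioc (0:ℝ) lam0,
      κ * (1 + lam) < Real.exp (-(lam * g σ 1))) := by
  constructor
  · intro lam hl hyp t ht
    have h1 : h σ t * (1 - t) ≤ 1 :=
      mul_le_one₀ (h_le_one σ t) (by linarith [ht.2]) (by linarith [ht.1])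
    have h2 : lam * h σ t * (1 - t) ≤ lam := by
      rw [mul_assoc]; exact mul_le_of_le_one_right hl.le h1
    have h3 : lam * g σ t ≤ lam * g σ 1 := mul_le_mul_of_nonneg_left (g_le σ t hσ ht.2) hl.le
    calc κ * (1 + lam * h σ t * (1 - t)) ≤ κ * (1 + lam) :=
          mul_le_mul_of_nonneg_left (by linarith) hκ.1.le
      _ < Real.exp (-(lam * g σ 1)) := hyp
      _ ≤ Real.exp (-(lam * g σ t)) := Real.exp_le_exp.2 (by linarith)
  · have hev : ∀ᶠ lam in nhds (0:ℝ), κ * (1 + lam) < Real.exp (-(lam * g σ 1)) := by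
      apply ContinuousAt.eventually_lt
      · fun_prop
      · fun_prop
      · simpa using hκ.2
    obtain ⟨ε, hε, H⟩ := Metric.eventually_nhds_iff.1 hev
    refine ⟨ε / 2, by positivity, fun lam hl => H ?_⟩
    rw [Real.dist_eq, sub_zero, abs_of_pos hl.1]
    linarith [hl.2]
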